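/- Let n ≥ 2 and let a be a positive integer. Suppose d = p^s for a prime p and a positive integer s, and set g = gcd(d,n). Then the triple (n,d,a) is bad if and only if g does not divide a. -/

import Mathlib

open MvPolynomial

/-- A sequence of polynomials is a regular sequence if each element is a
nonzerodivisor modulo the ideal generated by the previous ones. -/
def RegSeq {n : ℕ} (fs : List (MvPolynomial (Fin n) ℂ)) : Prop :=
  ∀ i : Fin fs.length, ∀ g : MvPolynomial (Fin n) ℂ,
    g * fs.get i ∈ Ideal.span {p | p ∈ fs.take i.1} →
    g ∈ Ideal.span {p | p ∈ fs.take i.1}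

/-- The sequence `x_1^d - x_n^d, …, x_{n-1}^d - x_n^d` in `ℂ[x_1,…,x_n]`. -/
noncomputable def powDiffSeq (n d : ℕ) : List (MvPolynomial (Fin n) ℂ) :=
  (List.finRange (n - 1)).map fun i =>
    X (⟨i.1, by have := i.isLt; omega⟩ : Fin n) ^ d -
    X (⟨n - 1, by have := i.isLt; omega⟩ : Fin n) ^ d

/-- The triple `(n,d,a)` is good if there is a homogeneous symmetric polynomial `f`
of degree `a` such that `x_1^d - x_n^d, …, x_{n-1}^d - x_n^d, f` is a regular
sequence. -/
def GoodTriple (n d a : ℕ) : Prop :=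
  ∃ f : MvPolynomial (Fin n) ℂ, f.IsHomogeneous a ∧ f.IsSymmetric ∧
    RegSeq (powDiffSeq n d ++ [f])

/-- The substitution `x_i ↦ ζ_i x_o` for `i ∈ T`, fixing the other variables. -/
noncomputable def lineSubst {ι : Type*} [DecidableEq ι] (T : Finset ι) (o : ι) (ζ : ι → ℂ) :
    MvPolynomial ι ℂ →ₐ[ℂ] MvPolynomial ι ℂ :=
  aeval fun i => if i ∈ T then C (ζ i) * X o else X i

/-- The ideal generated by the differences `x_i^d - x_o^d` for `i ∈ T`. -/
noncomputable def powDiffIdeal {ι : Type*} (T : Finset ι) (o : ι) (d : ℕ) :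
    Ideal (MvPolynomial ι ℂ) :=
  Ideal.span ((fun i => X i ^ d - X o ^ d) '' (T : Set ι))

theorem X_sub_dvd_sub_aeval_update {ι : Type*} [DecidableEq ι] (i : ι) (w h : MvPolynomial ι ℂ) :
    X i - w ∣ h - aeval (Function.update X i w) h := by
  rw [← Ideal.mem_span_singleton, ← Ideal.Quotient.mk_eq_mk_iff_sub_mem]
  have key : (Ideal.Quotient.mkₐ ℂ (Ideal.span {X i - w})).comp (aeval (Function.update X i w)) =
      Ideal.Quotient.mkₐ ℂ (Ideal.span {X i - w}) := by
    ext j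
    by_cases hj : j = i
    · subst hj
      simp only [AlgHom.comp_apply, aeval_X, Function.update_self, Ideal.Quotient.mkₐ_eq_mk]
      rw [eq_comm, Ideal.Quotient.mk_eq_mk_iff_sub_mem]
      exact Ideal.mem_span_singleton_self _
    · simp [hj]
  exact (DFunLike.congr_fun key h).symm

theorem aeval_update_aeval_update {ι : Type*} [DecidableEq ι]
    {i o : ι} (hio : o ≠ i) (ξ : ℂ) (w h : MvPolynomial ι ℂ) :
    aeval (Function.update X i w) (aeval (Function.update X i (C ξ * X o)) h) =
      aeval (Function.update X i (C ξ * X o)) h := by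
  rw [← AlgHom.comp_apply]
  congr 1
  ext1 j
  by_cases hj : j = i
  · subst hj
    simp [hio, ← algebraMap_eq]
  · simp [hj]

/-- Newton interpolation modulo an ideal on which `x_o` acts injectively. -/
theorem exists_sub_prod_mul_mem {ι : Type*} [DecidableEq ι]
    {i o : ι} (hio : o ≠ i) (J : Ideal (MvPolynomial ι ℂ))
    (hJ : ∀ g, X o * g ∈ J → g ∈ J) (S : Finset ℂ) (h : MvPolynomial ι ℂ)
    (hS : ∀ ζ ∈ S, aeval (Function.update X i (C ζ * X o)) h ∈ J) :
    ∃ q, h - (∏ ζ ∈ S, (X i - C ζ * X o)) * q ∈ J := by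
  induction S using Finset.induction_on generalizing h with
  | empty => exact ⟨h, by simp⟩
  | insert ξ S hξ ih =>
    obtain ⟨g, hg⟩ := X_sub_dvd_sub_aeval_update i (C ξ * X o) h
    have hcJ : aeval (Function.update X i (C ξ * X o)) h ∈ J := hS ξ (Finset.mem_insert_self _ _)
    obtain ⟨c, hc⟩ : ∃ c, c = aeval (Function.update X i (C ξ * X o)) h := ⟨_, rfl⟩
    rw [← hc] at hg hcJ
    have hgS : ∀ ζ ∈ S, aeval (Function.update X i (C ζ * X o)) g ∈ J := by
      intro ζ hζ
      have hfix : aeval (Function.update X i (C ζ * X o)) c = c := by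
        rw [hc, aeval_update_aeval_update hio]
      have hmem := hS ζ (Finset.mem_insert_of_mem hζ)
      have heq := congrArg (aeval (Function.update X i (C ζ * X o))) hg
      rw [map_sub, hfix, map_mul, map_sub, map_mul, aeval_X, aeval_X, Function.update_self,
        Function.update_of_ne hio, ← algebraMap_eq, AlgHom.commutes, algebraMap_eq] at heq
      have h2 : (C (ζ - ξ)⁻¹ : MvPolynomial ι ℂ) * (C ζ - C ξ) = 1 := by
        rw [← C_sub, ← C_mul, inv_mul_cancel₀ (sub_ne_zero.2 (ne_of_mem_of_not_mem hζ hξ)), C_1]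
      generalize aeval (Function.update X i (C ζ * X o)) g = g' at heq ⊢
      generalize aeval (Function.update X i (C ζ * X o)) h = h' at heq hmem
      have h1 : X o * g' = C (ζ - ξ)⁻¹ * (h' - c) := by
        linear_combination (-(X o * g')) * h2 - C (ζ - ξ)⁻¹ * heq
      exact hJ _ (h1 ▸ J.mul_mem_left _ (J.sub_mem hmem hcJ))
    obtain ⟨q, hq⟩ := ih g hgS
    refine ⟨q, ?_⟩
    rw [Finset.prod_insert hξ]
    have : h - (X i - C ξ * X o) * (∏ ζ ∈ S, (X i - C ζ * X o)) * q =
        c + (X i - C ξ * X o) * (g - (∏ ζ ∈ S, (X i - C ζ * X o)) * q) := by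
      linear_combination hg
    rw [this]
    exact J.add_mem hcJ (J.mul_mem_left _ hq)

theorem prod_nthRootsFinset_X_sub_C_mul_X {ι : Type*} {d : ℕ} (hd : 0 < d) (i o : ι) :
    ∏ ζ ∈ Polynomial.nthRootsFinset d (1 : ℂ), (X i - C ζ * X o : MvPolynomial ι ℂ) =
      X i ^ d - X o ^ d := by
  have hμ := Complex.isPrimitiveRoot_exp d hd.ne'
  have hμ' := hμ.map_of_injective (C_injective ι ℂ)
  have himg : (Polynomial.nthRootsFinset d (1 : ℂ)).map ⟨C, C_injective ι ℂ⟩ =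
      Polynomial.nthRootsFinset d (1 : MvPolynomial ι ℂ) := by
    apply Finset.eq_of_subset_of_card_le
    · intro x hx
      obtain ⟨y, hy, rfl⟩ := Finset.mem_map.1 hx
      rw [Polynomial.mem_nthRootsFinset hd] at hy ⊢
      simp [← C_pow, hy]
    · rw [Finset.card_map, hμ.card_nthRootsFinset, hμ'.card_nthRootsFinset]
  rw [hμ'.pow_sub_pow_eq_prod_sub_mul _ _ hd, ← himg, Finset.prod_map]
  rfl

theorem lineSubst_X_of_notMem {ι : Type*} [DecidableEq ι]
    {T : Finset ι} {i : ι} (hi : i ∉ T) (o : ι) (ζ : ι → ℂ) :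
    lineSubst T o ζ (X i) = X i := by
  simp [lineSubst, hi]

theorem lineSubst_X_of_mem {ι : Type*} [DecidableEq ι]
    {T : Finset ι} {i : ι} (hi : i ∈ T) (o : ι) (ζ : ι → ℂ) :
    lineSubst T o ζ (X i) = C (ζ i) * X o := by
  simp [lineSubst, hi]

theorem powDiffIdeal_le_ker_lineSubst {ι : Type*} [DecidableEq ι]
    {d : ℕ} {T : Finset ι} {o : ι} (ho : o ∉ T) {ζ : ι → ℂ}
    (hζ : ∀ i, ζ i ^ d = 1) : powDiffIdeal T o d ≤ RingHom.ker (lineSubst T o ζ) := by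
  refine Ideal.span_le.2 ?_
  rintro _ ⟨i, hi, rfl⟩
  simp [lineSubst_X_of_mem (Finset.mem_coe.1 hi), lineSubst_X_of_notMem ho, mul_pow,
    ← C_pow, hζ i]

/-- The ideal `(x_i^d - x_o^d)_{i ∈ T}` is the ideal of a union of linear subspaces. -/
theorem mem_powDiffIdeal_iff {ι : Type*} [DecidableEq ι]
    {d : ℕ} (hd : 0 < d) {T : Finset ι} {o : ι} (ho : o ∉ T)
    (h : MvPolynomial ι ℂ) :
    h ∈ powDiffIdeal T o d ↔ ∀ ζ : ι → ℂ, (∀ i, ζ i ^ d = 1) → lineSubst T o ζ h = 0 := by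
  constructor
  · exact fun hh ζ hζ => powDiffIdeal_le_ker_lineSubst ho hζ hh
  · induction T using Finset.induction_on generalizing h with
    | empty =>
      intro hh
      have h0 := hh 1 (by simp)
      have : lineSubst (∅ : Finset ι) o 1 = AlgHom.id ℂ (MvPolynomial ι ℂ) := by
        ext1 j
        simp [lineSubst]
      rw [this] at h0
      simp only [AlgHom.id_apply] at h0
      simp [h0]
    | insert i T hi ih =>
      intro hh
      rw [Finset.mem_insert, not_or] at ho
      have hle : powDiffIdeal T o d ≤ powDiffIdeal (insert i T) o d :=
        Ideal.span_mono (Set.image_mono (by simp))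
      obtain ⟨q, hq⟩ := exists_sub_prod_mul_mem ho.1 (powDiffIdeal T o d)
        (fun g hg => ih ho.2 g fun ζ hζ => by
          have h0 : lineSubst T o ζ (X o * g) = 0 := powDiffIdeal_le_ker_lineSubst ho.2 hζ hg
          rw [map_mul, lineSubst_X_of_notMem ho.2] at h0
          exact (mul_eq_zero.1 h0).resolve_left (X_ne_zero o))
        (Polynomial.nthRootsFinset d (1 : ℂ)) h
        (fun ξ hξ => ih ho.2 _ fun ζ hζ => by
          rw [Polynomial.mem_nthRootsFinset hd] at hξ
          rw [← hh (Function.update ζ i ξ) fun j => by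
            by_cases hj : j = i
            · subst hj; simpa using hξ
            · simpa [hj] using hζ j]
          rw [← AlgHom.comp_apply]
          congr 1
          ext1 j
          by_cases hj : j = i
          · subst hj
            simp [lineSubst, ho.2, ← algebraMap_eq]
          · by_cases hjT : j ∈ T <;> simp [lineSubst, hj, hjT])
      rw [prod_nthRootsFinset_X_sub_C_mul_X hd] at hq
      rw [← sub_add_cancel h ((X i ^ d - X o ^ d) * q)]
      refine Ideal.add_mem _ (hle hq) (Ideal.mul_mem_right _ _ (Ideal.subset_span ⟨i, by simp, rfl⟩))

theorem aeval_C_mul_X_of_isHomogeneous {ι : Type*}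
    {f : MvPolynomial ι ℂ} {a : ℕ} (hf : f.IsHomogeneous a)
    (o : ι) (z : ι → ℂ) :
    aeval (fun i => C (z i) * X o : ι → MvPolynomial ι ℂ) f = C (eval z f) * X o ^ a := by
  rw [aeval_def, eval₂_eq, eval_eq, map_sum, Finset.sum_mul]
  refine Finset.sum_congr rfl fun m hm => ?_
  have hdeg : ∑ i ∈ m.support, m i = a := by
    have := hf (mem_support_iff.1 hm)
    simpa [Finsupp.weight_apply, Finsupp.sum] using this
  simp only [mul_pow, Finset.prod_mul_distrib, Finset.prod_pow_eq_pow_sum, hdeg, algebraMap_eq,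
    C_mul, map_prod, C_pow, mul_assoc]

theorem isHomogeneous_psum {σ : Type*} [Fintype σ] (k : ℕ) :
    (psum σ ℂ k).IsHomogeneous k :=
  IsHomogeneous.sum _ _ _ fun i _ => isHomogeneous_X_pow i k

theorem isHomogeneous_esymm {σ : Type*} [Fintype σ] (k : ℕ) :
    (esymm σ ℂ k).IsHomogeneous k := by
  refine IsHomogeneous.sum _ _ _ fun t ht => ?_
  have := IsHomogeneous.prod t (fun i => (X i : MvPolynomial σ ℂ)) (fun _ => 1)
    fun i _ => isHomogeneous_X ℂ i
  simpa [(Finset.mem_powersetCard.1 ht).2] using this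

theorem choose_prime_pow_not_dvd {p r m : ℕ} (hp : p.Prime) (hm : ¬ p ∣ m) :
    ¬ p ∣ (p ^ r * m).choose (p ^ r) := by
  have := Fact.mk hp
  have h := Choose.choose_pow_mul_pow_mul_modEq_choose_nat (p := p) (k := r) (a := m) (b := 1)
  rw [mul_one, Nat.choose_one_right] at h
  rwa [h.dvd_iff dvd_rfl]

/-- A sum of roots of unity of order `p ^ s` vanishes only if the number of terms is divisible
by `p`. -/
theorem prime_dvd_card_of_sum_eq_zero {p s : ℕ} (hp : p.Prime) (hs : 0 < s) {α : Type*}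
    (A : Finset α) (w : α → ℂ) (hw : ∀ t ∈ A, w t ^ p ^ s = 1) (h0 : ∑ t ∈ A, w t = 0) :
    p ∣ A.card := by
  have := Fact.mk hp
  have hpos : 0 < p ^ s := pow_pos hp.pos s
  have hμ := Complex.isPrimitiveRoot_exp (p ^ s) hpos.ne'
  have : NeZero (p ^ s) := ⟨hpos.ne'⟩
  have hex : ∀ t : α, ∃ k : ℕ, t ∈ A →
      Complex.exp (2 * Real.pi * Complex.I / (p ^ s : ℕ)) ^ k = w t :=
    fun t => by
      by_cases ht : t ∈ A
      · obtain ⟨k, -, hk⟩ := hμ.eq_pow_of_pow_eq_one (hw t ht)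
        exact ⟨k, fun _ => hk⟩
      · exact ⟨0, fun h => absurd h ht⟩
  choose k hk using hex
  let q : Polynomial ℤ := ∑ t ∈ A, Polynomial.X ^ k t
  have hq : Polynomial.aeval (Complex.exp (2 * Real.pi * Complex.I / (p ^ s : ℕ))) q = 0 := by
    rw [← h0]
    simp only [q, map_sum, map_pow, Polynomial.aeval_X]
    exact Finset.sum_congr rfl hk
  have hdvd := minpoly.isIntegrallyClosed_dvd (hμ.isIntegral hpos) hq
  rw [← Polynomial.cyclotomic_eq_minpoly hμ hpos] at hdvd
  have h1 := Polynomial.eval_dvd (x := 1) hdvd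
  obtain ⟨s, rfl⟩ := Nat.exists_eq_add_of_le' hs
  rw [Polynomial.eval_one_cyclotomic_prime_pow] at h1
  simp only [q, Polynomial.eval_finsetSum, Polynomial.eval_pow, Polynomial.eval_X, one_pow,
    Finset.sum_const, nsmul_eq_mul, mul_one] at h1
  exact_mod_cast h1

theorem exists_symmetric_eval_ne_zero {n d a p s : ℕ} (hn : 0 < n)
    (hp : p.Prime) (hs : 0 < s) (hd : d = p ^ s) (hga : Nat.gcd d n ∣ a) :
    ∃ f : MvPolynomial (Fin n) ℂ, f.IsHomogeneous a ∧ f.IsSymmetric ∧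
      ∀ z : Fin n → ℂ, (∀ i, z i ^ d = 1) → eval z f ≠ 0 := by
  suffices h : ∃ f : MvPolynomial (Fin n) ℂ, f.IsHomogeneous (d.gcd n) ∧ f.IsSymmetric ∧
      ∀ z : Fin n → ℂ, (∀ i, z i ^ d = 1) → eval z f ≠ 0 by
    obtain ⟨f, hf, hsym, hz⟩ := h
    obtain ⟨b, rfl⟩ := hga
    exact ⟨f ^ b, hf.pow b, pow_mem (S := symmetricSubalgebra (Fin n) ℂ) hsym b,
      fun z h => by simpa using pow_ne_zero b (hz z h)⟩
  by_cases hdn : d ∣ n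
  · rw [Nat.gcd_eq_left hdn]
    refine ⟨psum (Fin n) ℂ d, isHomogeneous_psum d, psum_isSymmetric _ _ d, fun z hz => ?_⟩
    simp [psum, hz, hn.ne']
  · obtain ⟨r, m, hm, hnr⟩ := Nat.exists_eq_pow_mul_and_not_dvd hn.ne' p hp.ne_one
    have hrs : r < s := by
      by_contra! h
      exact hdn (hd ▸ hnr ▸ (pow_dvd_pow p h).mul_right m)
    have hg : d.gcd n = p ^ r := by
      obtain ⟨t, rfl⟩ := Nat.exists_eq_add_of_le hrs.le
      rw [hd, hnr, pow_add, Nat.gcd_mul_left,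
        ((Nat.Prime.coprime_iff_not_dvd hp).2 hm).pow_left t |>.gcd_eq_one, mul_one]
    rw [hg]
    refine ⟨esymm (Fin n) ℂ (p ^ r), isHomogeneous_esymm _, esymm_isSymmetric _ _ _,
      fun z hz h0 => choose_prime_pow_not_dvd (r := r) hp hm ?_⟩
    have := prime_dvd_card_of_sum_eq_zero hp hs (Finset.powersetCard (p ^ r) Finset.univ)
      (fun t : Finset (Fin n) => ∏ i ∈ t, z i)
      (fun t _ => by rw [← Finset.prod_pow]; exact Finset.prod_eq_one fun i _ => hd ▸ hz i)
      (by simpa [esymm] using h0)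
    rwa [Finset.card_powersetCard, Finset.card_univ, Fintype.card_fin, hnr] at this

/-- A point with root-of-unity coordinates at which all symmetric forms of degree not divisible
by `g` vanish. -/
theorem exists_eval_eq_zero {n d a : ℕ} (hn : 2 ≤ n) (hga : ¬ Nat.gcd d n ∣ a) :
    ∃ z : Fin n → ℂ, (∀ i, z i ^ d = 1) ∧ z ⟨n - 1, by omega⟩ = 1 ∧
      ∀ f : MvPolynomial (Fin n) ℂ, f.IsHomogeneous a → f.IsSymmetric → eval z f = 0 := by
  obtain ⟨n, rfl⟩ : ∃ m, n = m + 1 := ⟨n - 1, by omega⟩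
  set g := d.gcd (n + 1) with hg
  have hgpos : 0 < g := Nat.gcd_pos_of_pos_right _ (by omega)
  have hω := Complex.isPrimitiveRoot_exp g hgpos.ne'
  set ω := Complex.exp (2 * Real.pi * Complex.I / g)
  have hωn : ω ^ (n + 1) = 1 := (hω.pow_eq_one_iff_dvd _).2 (Nat.gcd_dvd_right _ _)
  have hωd : ω ^ d = 1 := (hω.pow_eq_one_iff_dvd _).2 (Nat.gcd_dvd_left _ _)
  refine ⟨fun i => ω ^ (i.1 + 1), fun i => by rw [pow_right_comm, hωd, one_pow], hωn, ?_⟩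
  intro f hf hsym
  have hrot : (fun i : Fin (n + 1) => ω ^ (i.1 + 1)) ∘ finRotate (n + 1) =
      fun i => ω * ω ^ (i.1 + 1) := by
    funext i
    rcases i.eq_castSucc_or_eq_last.symm with rfl | ⟨j, rfl⟩
    · simp [hωn]
    · simp [← pow_succ']
  have h1 : eval (fun i : Fin (n + 1) => ω * ω ^ (i.1 + 1)) f =
      eval (fun i : Fin (n + 1) => ω ^ (i.1 + 1)) f := by
    rw [← hrot, ← eval_rename, hsym]
  have h2 : eval (fun i : Fin (n + 1) => ω * ω ^ (i.1 + 1)) f =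
      ω ^ a * eval (fun i : Fin (n + 1) => ω ^ (i.1 + 1)) f := by
    rw [eval_eq, eval_eq, Finset.mul_sum]
    refine Finset.sum_congr rfl fun m hm => ?_
    have hdeg : ∑ i ∈ m.support, m i = a := by
      have := hf (mem_support_iff.1 hm)
      simpa [Finsupp.weight_apply, Finsupp.sum] using this
    simp only [mul_pow, Finset.prod_mul_distrib, Finset.prod_pow_eq_pow_sum, hdeg]
    ring
  have hne : ω ^ a ≠ 1 := fun h => hga ((hω.pow_eq_one_iff_dvd _).1 h)
  have h3 : (ω ^ a - 1) * eval (fun i : Fin (n + 1) => ω ^ (i.1 + 1)) f = 0 := by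
    linear_combination h1 - h2
  exact (mul_eq_zero.1 h3).resolve_left (sub_ne_zero.2 hne)

theorem span_take_powDiffSeq {n d k : ℕ} (hn : 0 < n) (hk : k ≤ n - 1)
    (f : MvPolynomial (Fin n) ℂ) :
    Ideal.span {q | q ∈ (powDiffSeq n d ++ [f]).take k} =
      powDiffIdeal (Finset.univ.filter fun i : Fin n => i.1 < k) ⟨n - 1, by omega⟩ d := by
  have hlen : k ≤ (powDiffSeq n d).length := by simpa [powDiffSeq] using hk
  rw [List.take_append_of_le_length hlen, powDiffIdeal]
  congr 1
  ext q
  simp only [powDiffSeq, ← List.map_take, List.mem_map, List.mem_take_iff_getElem,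
    Set.mem_ofPred_eq, Set.mem_image, Finset.coe_filter, Finset.mem_univ, true_and]
  constructor
  · rintro ⟨i, ⟨j, hj, rfl⟩, rfl⟩
    refine ⟨⟨j, by simp at hj; omega⟩, by simp at hj ⊢; omega, by simp⟩
  · rintro ⟨i, hi, rfl⟩
    exact ⟨⟨i.1, by omega⟩, ⟨i.1, by simp; omega, by simp⟩, rfl⟩

theorem val_lt_of_ne_last {n : ℕ} {hn : n - 1 < n} {i : Fin n} (hi : i ≠ ⟨n - 1, hn⟩) :
    i.1 < n - 1 := by
  rw [Ne, Fin.ext_iff] at hi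
  dsimp only at hi
  omega

theorem lineSubst_eq_C_mul {n a : ℕ} (hn : 0 < n) {f : MvPolynomial (Fin n) ℂ}
    (hf : f.IsHomogeneous a) (z : Fin n → ℂ) :
    lineSubst (Finset.univ.filter fun i : Fin n => i.1 < n - 1) ⟨n - 1, by omega⟩ z f =
      C (eval (Function.update z ⟨n - 1, by omega⟩ 1) f) * X ⟨n - 1, by omega⟩ ^ a := by
  rw [← aeval_C_mul_X_of_isHomogeneous hf, lineSubst]
  congr 2
  funext i
  by_cases hi : i = ⟨n - 1, by omega⟩
  · subst hi
    simp
  · have : i.1 < n - 1 := val_lt_of_ne_last hi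
    simp [hi, this]

theorem regSeq_append_of_eval_ne_zero {n d a : ℕ} (hn : 0 < n) (hd : 0 < d)
    {f : MvPolynomial (Fin n) ℂ} (hf : f.IsHomogeneous a)
    (hz : ∀ z : Fin n → ℂ, (∀ i, z i ^ d = 1) → eval z f ≠ 0) :
    RegSeq (powDiffSeq n d ++ [f]) := by
  rintro ⟨k, hk⟩ g hg
  have hlen : (powDiffSeq n d).length = n - 1 := by simp [powDiffSeq]
  have hk' : k ≤ n - 1 := by simp [hlen] at hk; omega
  have ho : (⟨n - 1, by omega⟩ : Fin n) ∉ Finset.univ.filter fun i : Fin n => i.1 < k := by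
    simpa using hk'
  rw [span_take_powDiffSeq hn hk', mem_powDiffIdeal_iff hd ho] at hg ⊢
  intro ζ hζ
  have h0 := hg ζ hζ
  rw [map_mul] at h0
  refine (mul_eq_zero.1 h0).resolve_right ?_
  rcases hk'.eq_or_lt with rfl | hlt
  · have hget : (powDiffSeq n d ++ [f]).get ⟨n - 1, hk⟩ = f := by
      simp [List.getElem_append_right, hlen]
    rw [hget, lineSubst_eq_C_mul hn hf]
    refine mul_ne_zero (C_ne_zero.2 (hz _ fun i => ?_)) (pow_ne_zero _ (X_ne_zero _))
    by_cases hi : i = ⟨n - 1, by omega⟩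
    · subst hi
      simp
    · simpa [hi] using hζ i
  · have hget : (powDiffSeq n d ++ [f]).get ⟨k, hk⟩ =
        X ⟨k, by omega⟩ ^ d - X ⟨n - 1, by omega⟩ ^ d := by
      rw [List.get_eq_getElem, List.getElem_append_left (hlen ▸ hlt)]
      simp [powDiffSeq]
    rw [hget, map_sub, map_pow, map_pow, lineSubst_X_of_notMem ho,
      lineSubst_X_of_notMem (by simp)]
    intro h
    have h1 := congrArg (eval fun i : Fin n => if i.1 = k then (1 : ℂ) else 0) h
    simp [hd.ne', hlt.ne'] at h1

theorem eval_ne_zero_of_regSeq_append {n d a : ℕ} (hn : 0 < n) (hd : 0 < d)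
    {f : MvPolynomial (Fin n) ℂ} (hf : f.IsHomogeneous a)
    (hreg : RegSeq (powDiffSeq n d ++ [f])) {z : Fin n → ℂ} (hz : ∀ i, z i ^ d = 1)
    (hz1 : z ⟨n - 1, by omega⟩ = 1) : eval z f ≠ 0 := by
  intro hzero
  have hlen : (powDiffSeq n d).length = n - 1 := by simp [powDiffSeq]
  have hk : n - 1 < (powDiffSeq n d ++ [f]).length := by simp [hlen]
  have hget : (powDiffSeq n d ++ [f]).get ⟨n - 1, hk⟩ = f := by
    simp [List.getElem_append_right, hlen]
  have ho : (⟨n - 1, by omega⟩ : Fin n) ∉ Finset.univ.filter fun i : Fin n => i.1 < n - 1 := by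
    simp
  have h := hreg ⟨n - 1, hk⟩ (∏ i ∈ Finset.univ.filter (fun i : Fin n => i.1 < n - 1),
    ∏ η ∈ (Polynomial.nthRootsFinset d (1 : ℂ)).erase (z i),
      (X i - C η * X ⟨n - 1, by omega⟩))
  rw [hget, span_take_powDiffSeq hn le_rfl, mem_powDiffIdeal_iff hd ho,
    mem_powDiffIdeal_iff hd ho] at h
  have h0 := h (fun ζ hζ => by
    rw [map_mul]
    by_cases hex : ∃ i : Fin n, i.1 < n - 1 ∧ ζ i ≠ z i
    · obtain ⟨i, hi, hne⟩ := hex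
      have hi' : i ∈ Finset.univ.filter fun i : Fin n => i.1 < n - 1 := by simpa using hi
      rw [map_prod, Finset.prod_eq_zero hi', zero_mul]
      rw [map_prod]
      refine Finset.prod_eq_zero (i := ζ i) ?_ ?_
      · rw [Finset.mem_erase, Polynomial.mem_nthRootsFinset hd]
        exact ⟨hne, hζ i⟩
      · rw [map_sub, map_mul, lineSubst_X_of_mem hi', lineSubst_X_of_notMem ho, ← algebraMap_eq,
          AlgHom.commutes, sub_self]
    · push Not at hex
      have hupd : Function.update ζ ⟨n - 1, by omega⟩ 1 = z := by
        funext i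
        by_cases hi : i = ⟨n - 1, by omega⟩
        · subst hi
          simp [hz1]
        · have hlt : i.1 < n - 1 := val_lt_of_ne_last hi
          simp [hi, hex i hlt]
      rw [lineSubst_eq_C_mul hn hf, hupd, hzero, C_0, zero_mul, mul_zero]) z hz
  rw [map_prod, Finset.prod_eq_zero_iff] at h0
  obtain ⟨i, hi, h0⟩ := h0
  rw [map_prod, Finset.prod_eq_zero_iff] at h0
  obtain ⟨η, hη, h0⟩ := h0
  rw [map_sub, map_mul, lineSubst_X_of_mem hi, lineSubst_X_of_notMem ho, ← algebraMap_eq,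
    AlgHom.commutes, ← sub_mul, algebraMap_eq, ← C_sub] at h0
  rcases mul_eq_zero.1 h0 with h1 | h1
  · exact (Finset.mem_erase.1 hη).1 (sub_eq_zero.1 (C_eq_zero.1 h1)).symm
  · exact X_ne_zero _ h1

theorem prime_power (n d a p s : ℕ) (hn : 2 ≤ n) (ha : 0 < a)
    (hp : p.Prime) (hs : 0 < s) (hd : d = p ^ s) :
    (¬ GoodTriple n d a) ↔ ¬ Nat.gcd d n ∣ a := by
  have hdpos : 0 < d := hd ▸ pow_pos hp.pos s
  rw [not_iff_not]
  constructor
  · rintro ⟨f, hf, hsym, hreg⟩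
    by_contra hga
    obtain ⟨z, hz, hz1, hzero⟩ := exists_eval_eq_zero hn hga
    exact eval_ne_zero_of_regSeq_append (by omega) hdpos hf hreg hz hz1 (hzero f hf hsym)
  · intro hga
    obtain ⟨f, hf, hsym, hz⟩ := exists_symmetric_eval_ne_zero (by omega) hp hs hd hga
    exact ⟨f, hf, hsym, regSeq_append_of_eval_ne_zero (by omega) hdpos hf hz⟩
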